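/- If a monoid ℬ of linear isomorphisms of H is simple (twisting and pinching), then the inverse monoid ℬ⁻¹ = {x⁻¹ : x ∈ ℬ} is also simple. -/

import Mathlib

open Module

/-- The `k`-th singular value of `x` (1-indexed, decreasing), via the Courant–Fischer
characterization: the supremum of all `r ≥ 0` such that `‖x v‖ ≥ r ‖v‖` on some
`k`-dimensional subspace. -/
noncomputable def sVal {H : Type*} [NormedAddCommGroup H] [InnerProductSpace ℝ H]
    (x : H →ₗ[ℝ] H) (k : ℕ) : ℝ :=
  sSup {r : ℝ | 0 ≤ r ∧ ∃ F : Submodule ℝ H, finrank ℝ F = k ∧ ∀ v ∈ F, r * ‖v‖ ≤ ‖x v‖}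

/-- `ℬ` twists `F ∈ Grass(k,H)`. -/
def Twists {H : Type*} [NormedAddCommGroup H] [InnerProductSpace ℝ H] [FiniteDimensional ℝ H]
    (ℬ : Set (H ≃ₗ[ℝ] H)) (k : ℕ) (F : Submodule ℝ H) : Prop :=
  ∀ 𝒢 : Finset (Submodule ℝ H), (∀ G ∈ 𝒢, finrank ℝ G = finrank ℝ H - k) →
    ∃ x ∈ ℬ, ∀ G ∈ 𝒢, Submodule.map x.toLinearMap F ⊓ G = ⊥

/-- `ℬ` is twisting: it twists every `F ∈ Grass(k,H)` for every `1 ≤ k ≤ dim H − 1`. -/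
def IsTwisting {H : Type*} [NormedAddCommGroup H] [InnerProductSpace ℝ H] [FiniteDimensional ℝ H]
    (ℬ : Set (H ≃ₗ[ℝ] H)) : Prop :=
  ∀ k : ℕ, 1 ≤ k → k ≤ finrank ℝ H - 1 →
    ∀ F : Submodule ℝ H, finrank ℝ F = k → Twists ℬ k F

/-- `ℬ` is pinching: for every `C > 0` some element has all consecutive singular value
ratios larger than `C`. -/
def IsPinching {H : Type*} [NormedAddCommGroup H] [InnerProductSpace ℝ H] [FiniteDimensional ℝ H]
    (ℬ : Set (H ≃ₗ[ℝ] H)) : Prop :=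
  ∀ C : ℝ, 0 < C → ∃ x ∈ ℬ, ∀ i : ℕ, 1 ≤ i → i ≤ finrank ℝ H - 1 →
    C * sVal x.toLinearMap (i + 1) < sVal x.toLinearMap i

open TopologicalSpace in
/-- In a Noetherian space, a closed set stable under a homeomorphism is also stable under its
inverse. -/
theorem IsClosed.symm_mem_of_mapsTo {X : Type*} [TopologicalSpace X] [NoetherianSpace X]
    (f : X ≃ₜ X) {A : Set X} (hA : IsClosed A) (hf : ∀ a ∈ A, f a ∈ A) :
    ∀ a ∈ A, f.symm a ∈ A := by
  lift A to Closeds X using hA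
  induction A using WellFoundedLT.induction with
  | _ A ih =>
    by_contra! hne
    obtain ⟨a, ha, hna⟩ := hne
    let B : Closeds X := ⟨f.symm ⁻¹' A, A.isClosed.preimage f.symm.continuous⟩
    have hBA : B < A := by
      refine lt_of_le_of_ne (fun b (hb : f.symm b ∈ A) => ?_) ?_
      · simpa using hf _ hb
      · intro h
        have : a ∈ B := h ▸ ha
        exact hna this
    have h := ih B hBA
      (fun b (hb : f.symm b ∈ A) => show f.symm (f b) ∈ A by simpa using hf _ hb)
      (f a) (show f.symm (f a) ∈ A by simpa using ha)
    exact hna (by simpa [B] using h)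

open TopologicalSpace in
/-- If finitely many closed sets cover a submonoid of a group carrying a Noetherian topology with
continuous left translations, then finitely many translates of one of them cover it. -/
theorem exists_finset_translates_cover {G : Type*} [Group G] [TopologicalSpace G]
    [NoetherianSpace G] (hmul : ∀ g : G, Continuous fun x => g * x) (M : Submonoid G)
    (𝒱 : Finset (Set G)) (hclosed : ∀ V ∈ 𝒱, IsClosed V) (hcover : (M : Set G) ⊆ ⋃₀ ↑𝒱) :
    ∃ V ∈ 𝒱, ∃ T : Finset G, ∀ x ∈ M, ∃ g ∈ T, g⁻¹ * x ∈ V := by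
  classical
  let L : G → G ≃ₜ G := fun g =>
    { Equiv.mulLeft g with
      continuous_toFun := hmul g
      continuous_invFun := hmul g⁻¹ }
  set N : Set G := closure (M : Set G)
  have hmulN : ∀ y ∈ M, ∀ a ∈ N, L y a ∈ N := fun y hy a ha =>
    map_mem_closure (hmul y) ha fun m hm => M.mul_mem hy hm
  have hinvN : ∀ y ∈ M, ∀ a ∈ N, (L y).symm a ∈ N := fun y hy =>
    isClosed_closure.symm_mem_of_mapsTo (L y) (hmulN y hy)
  obtain ⟨S, hSfin, hSclosed, hSirr, hNS⟩ :=
    NoetherianSpace.exists_finite_set_isClosed_irreducible (isClosed_closure (s := (M : Set G)))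
  have hsub : ∀ s ∈ S, s ⊆ N := fun s hs => by
    change s ⊆ closure (M : Set G); rw [hNS]; exact Set.subset_sUnion_of_mem hs
  have hirr : ∀ Z : Set G, IsIrreducible Z → Z ⊆ N → ∃ s ∈ S, Z ⊆ s := fun Z hZ hZN => by
    obtain ⟨s, hs, hZs⟩ := isIrreducible_iff_sUnion_isClosed.1 hZ hSfin.toFinset
      (fun z hz => hSclosed z (hSfin.mem_toFinset.1 hz)) (by simpa [← hNS] using hZN)
    exact ⟨s, hSfin.mem_toFinset.1 hs, hZs⟩
  obtain ⟨s₀, hs₀, h1s₀⟩ : ∃ s ∈ S, (1 : G) ∈ s := by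
    have : (1 : G) ∈ closure (M : Set G) := subset_closure M.one_mem
    rwa [hNS] at this
  obtain ⟨Z, hs₀Z, hZS, hZmax⟩ := hSfin.exists_le_maximal hs₀
  have htrans : ∀ x ∈ M, L x '' Z ∈ S := fun x hx => by
    obtain ⟨s, hs, hle⟩ := hirr (L x '' Z) ((hSirr Z hZS).image _ (L x).continuous.continuousOn)
      (by rintro _ ⟨z, hz, rfl⟩; exact hmulN x hx z (hsub Z hZS hz))
    obtain ⟨s', hs', hle'⟩ := hirr ((L x).symm '' s)
      ((hSirr s hs).image _ (L x).symm.continuous.continuousOn)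
      (by rintro _ ⟨z, hz, rfl⟩; exact hinvN x hx z (hsub s hs hz))
    have hZs' : Z ⊆ s' := fun z hz => hle' ⟨L x z, hle ⟨z, hz, rfl⟩, by simp⟩
    have hs'Z : s' ⊆ Z := hZmax hs' hZs'
    have : L x '' Z = s := hle.antisymm fun a ha =>
      ⟨(L x).symm a, hs'Z (hle' ⟨a, ha, rfl⟩), by simp⟩
    exact this ▸ hs
  have hZN : Z ⊆ closure (⋃₀ (𝒱 : Set (Set G))) := (hsub Z hZS).trans (closure_mono hcover)
  have hUclosed : IsClosed (⋃₀ (𝒱 : Set (Set G))) := by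
    rw [Set.sUnion_eq_biUnion]
    exact 𝒱.finite_toSet.isClosed_biUnion hclosed
  rw [hUclosed.closure_eq] at hZN
  obtain ⟨V, hV, hZV⟩ := isIrreducible_iff_sUnion_isClosed.1 (hSirr Z hZS) 𝒱 hclosed hZN
  have hfin : ((fun x => L x '' Z) '' (M : Set G)).Finite :=
    hSfin.subset (by rintro _ ⟨x, hx, rfl⟩; exact htrans x hx)
  choose! r hr using fun W (hW : W ∈ (fun x => L x '' Z) '' (M : Set G)) => hW
  refine ⟨V, hV, hfin.toFinset.image r, fun x hx => ?_⟩
  have hxmem : L x '' Z ∈ (fun x => L x '' Z) '' (M : Set G) := ⟨x, hx, rfl⟩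
  refine ⟨r (L x '' Z), Finset.mem_image_of_mem r (hfin.mem_toFinset.2 hxmem), ?_⟩
  have hxr : x ∈ L (r (L x '' Z)) '' Z :=
    (hr _ hxmem).2.symm.subset ⟨1, hs₀Z h1s₀, mul_one x⟩
  obtain ⟨z, hz, hzx⟩ := hxr
  have hzr : (r (L x '' Z))⁻¹ * x = z := inv_mul_eq_iff_eq_mul.2 hzx.symm
  exact hZV (hzr ▸ hz)

theorem OrthonormalBasis.finrank_span_image {H ι : Type*} [NormedAddCommGroup H]
    [InnerProductSpace ℝ H] [Fintype ι] (e : OrthonormalBasis ι ℝ H) (s : Finset ι) :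
    finrank ℝ (Submodule.span ℝ (e '' s)) = s.card := by
  classical
  have hli : LinearIndependent ℝ (fun i : s => e i) :=
    e.orthonormal.linearIndependent.comp _ Subtype.val_injective
  have h := finrank_span_eq_card hli
  rw [Fintype.card_coe] at h
  rw [← h, Set.image_eq_range]
  rfl

theorem OrthonormalBasis.inner_eq_zero_of_mem_span_image {H ι : Type*} [NormedAddCommGroup H]
    [InnerProductSpace ℝ H] [Fintype ι] (e : OrthonormalBasis ι ℝ H) {s : Set ι} {v : H}
    (hv : v ∈ Submodule.span ℝ (e '' s)) {i : ι} (hi : i ∉ s) : inner ℝ (e i) v = 0 := by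
  induction hv using Submodule.span_induction with
  | mem w hw =>
    obtain ⟨j, hj, rfl⟩ := hw
    exact e.orthonormal.2 fun h => hi (h ▸ hj)
  | zero => simp
  | add a b _ _ ha hb => rw [inner_add_right, ha, hb, add_zero]
  | smul c a _ ha => rw [inner_smul_right, ha, mul_zero]

/-- Singular value decomposition of an isomorphism, in terms of subspaces: for each `1 ≤ k ≤ dim H`
there is `s > 0` such that `x` expands by at least `s` on a `k`-dimensional subspace and by at most
`s` on a subspace of dimension `dim H - k + 1`. -/
theorem exists_singular_subspaces {H : Type*} [NormedAddCommGroup H] [InnerProductSpace ℝ H]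
    [FiniteDimensional ℝ H] (x : H ≃ₗ[ℝ] H) {k : ℕ} (hk : 1 ≤ k) (hkd : k ≤ finrank ℝ H) :
    ∃ s : ℝ, 0 < s ∧
      (∃ P : Submodule ℝ H, finrank ℝ P = k ∧ ∀ v ∈ P, s * ‖v‖ ≤ ‖x v‖) ∧
      ∃ Q : Submodule ℝ H, finrank ℝ Q = finrank ℝ H + 1 - k ∧ ∀ v ∈ Q, ‖x v‖ ≤ s * ‖v‖ := by
  have hT : (x.toLinearMap.adjoint ∘ₗ x.toLinearMap).IsSymmetric :=
    LinearMap.isSymmetric_adjoint_mul_self _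
  set e := hT.eigenvectorBasis rfl
  set l := hT.eigenvalues rfl
  have hanti : Antitone l := hT.eigenvalues_antitone rfl
  have hnorm : ∀ v, ‖x v‖ ^ 2 = ∑ i, l i * inner ℝ (e i) v ^ 2 := fun v => by
    have h1 : ‖x v‖ ^ 2 = inner ℝ ((x.toLinearMap.adjoint ∘ₗ x.toLinearMap) v) v := by
      rw [LinearMap.comp_apply, LinearMap.adjoint_inner_left]
      exact (real_inner_self_eq_norm_sq (x v)).symm
    rw [h1, ← e.sum_inner_mul_inner]
    refine Finset.sum_congr rfl fun i _ => ?_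
    rw [hT, hT.apply_eigenvectorBasis, inner_smul_right, real_inner_comm v]
    simp only [RCLike.ofReal_real_eq_id, id]
    ring
  have hnorm' : ∀ v, ‖v‖ ^ 2 = ∑ i, inner ℝ (e i) v ^ 2 := fun v => by
    rw [← e.sum_sq_norm_inner_right v]
    simp
  let j : Fin (finrank ℝ H) := ⟨k - 1, by omega⟩
  have hpos : 0 < l j := by
    have h := hnorm (e j)
    have hne : x (e j) ≠ 0 := by
      simpa using e.orthonormal.ne_zero j
    have hsum : ∑ i, l i * inner ℝ (e i) (e j) ^ 2 = l j := by
      rw [Finset.sum_eq_single j]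
      · simp [e.orthonormal.1 j]
      · intro i _ hij
        rw [e.orthonormal.2 hij]; simp
      · simp
    rw [← hsum, ← h]
    positivity
  refine ⟨√(l j), Real.sqrt_pos.2 hpos,
    ⟨Submodule.span ℝ (e '' (Finset.Iic j : Finset _)), ?_, fun v hv => ?_⟩,
    ⟨Submodule.span ℝ (e '' (Finset.Ici j : Finset _)), ?_, fun v hv => ?_⟩⟩
  · rw [e.finrank_span_image, Fin.card_Iic]
    simp only [j]; omega
  · refine le_of_sq_le_sq ?_ (norm_nonneg _)
    rw [mul_pow, Real.sq_sqrt hpos.le, hnorm, hnorm', Finset.mul_sum]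
    refine Finset.sum_le_sum fun i _ => ?_
    by_cases hi : i ≤ j
    · exact mul_le_mul_of_nonneg_right (hanti hi) (sq_nonneg _)
    · rw [e.inner_eq_zero_of_mem_span_image hv (by simpa using hi)]; simp
  · rw [e.finrank_span_image, Fin.card_Ici]
    simp only [j]; omega
  · refine le_of_sq_le_sq ?_ (by positivity)
    rw [mul_pow, Real.sq_sqrt hpos.le, hnorm, hnorm', Finset.mul_sum]
    refine Finset.sum_le_sum fun i _ => ?_
    by_cases hi : j ≤ i
    · exact mul_le_mul_of_nonneg_right (hanti hi) (sq_nonneg _)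
    · rw [e.inner_eq_zero_of_mem_span_image hv (by simpa using hi)]; simp

theorem Submodule.exists_mem_ne_zero_of_finrank_lt_add {H : Type*} [AddCommGroup H] [Module ℝ H]
    [FiniteDimensional ℝ H] {P Q : Submodule ℝ H}
    (h : finrank ℝ H < finrank ℝ P + finrank ℝ Q) : ∃ v ∈ P, v ∈ Q ∧ v ≠ 0 := by
  by_contra! hne
  exact h.not_ge (Submodule.finrank_add_finrank_le_of_disjoint
    (Submodule.disjoint_def.2 hne))

/-- The `k`-th singular value of `x` and the `(dim H + 1 - k)`-th one of `x⁻¹` are inverse. -/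
theorem exists_sVal_eq_and_sVal_symm_eq {H : Type*} [NormedAddCommGroup H] [InnerProductSpace ℝ H]
    [FiniteDimensional ℝ H] (x : H ≃ₗ[ℝ] H) {k : ℕ} (hk : 1 ≤ k) (hkd : k ≤ finrank ℝ H) :
    ∃ s : ℝ, 0 < s ∧ sVal x.toLinearMap k = s ∧
      sVal x.symm.toLinearMap (finrank ℝ H + 1 - k) = s⁻¹ := by
  obtain ⟨s, hs, ⟨P, hP, hPs⟩, ⟨Q, hQ, hQs⟩⟩ := exists_singular_subspaces x hk hkd
  refine ⟨s, hs, IsGreatest.csSup_eq ⟨⟨hs.le, P, hP, hPs⟩, ?_⟩,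
    IsGreatest.csSup_eq ⟨⟨(inv_pos.2 hs).le, Q.map x.toLinearMap, ?_, ?_⟩, ?_⟩⟩
  · rintro r ⟨-, F, hF, hFr⟩
    obtain ⟨v, hvF, hvQ, hv⟩ := Submodule.exists_mem_ne_zero_of_finrank_lt_add
      (P := F) (Q := Q) (by omega)
    exact le_of_mul_le_mul_right ((hFr v hvF).trans (hQs v hvQ)) (norm_pos_iff.2 hv)
  · rw [← hQ]; exact LinearEquiv.finrank_map_eq x Q
  · rintro _ ⟨v, hv, rfl⟩
    rw [inv_mul_le_iff₀ hs]
    simpa using hQs v hv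
  · rintro r ⟨hr, F, hF, hFr⟩
    have hdim : finrank ℝ (F.map x.symm.toLinearMap) = finrank ℝ F :=
      LinearEquiv.finrank_map_eq x.symm F
    obtain ⟨_, ⟨w, hw, rfl⟩, hvP, hv⟩ := Submodule.exists_mem_ne_zero_of_finrank_lt_add
      (P := F.map x.symm.toLinearMap) (Q := P) (by omega)
    have h1 := hFr w hw
    have h2 := hPs _ hvP
    simp only [LinearEquiv.coe_coe, LinearEquiv.apply_symm_apply] at h1 h2 hv
    rw [← one_div, le_div_iff₀ hs]
    refine le_of_mul_le_mul_right ?_ (norm_pos_iff.2 hv)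
    calc r * s * ‖x.symm w‖ = r * (s * ‖x.symm w‖) := by ring
      _ ≤ r * ‖w‖ := mul_le_mul_of_nonneg_left h2 hr
      _ ≤ 1 * ‖x.symm w‖ := by simpa using h1

theorem IsPinching.image_symm {H : Type*} [NormedAddCommGroup H] [InnerProductSpace ℝ H]
    [FiniteDimensional ℝ H] {ℬ : Set (H ≃ₗ[ℝ] H)} (h : IsPinching ℬ) :
    IsPinching ((fun x : H ≃ₗ[ℝ] H => x.symm) '' ℬ) := by
  intro C hC
  obtain ⟨x, hx, hxC⟩ := h C hC
  refine ⟨x.symm, ⟨x, hx, rfl⟩, fun i hi hid => ?_⟩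
  have hlt := hxC (finrank ℝ H - i) (by omega) (by omega)
  obtain ⟨s, hs, hxs, hxs'⟩ := exists_sVal_eq_and_sVal_symm_eq x
    (k := finrank ℝ H - i) (by omega) (by omega)
  obtain ⟨t, ht, hxt, hxt'⟩ := exists_sVal_eq_and_sVal_symm_eq x
    (k := finrank ℝ H - i + 1) (by omega) (by omega)
  rw [hxs, hxt] at hlt
  rw [show finrank ℝ H + 1 - (finrank ℝ H - i) = i + 1 by omega] at hxs'
  rw [show finrank ℝ H + 1 - (finrank ℝ H - i + 1) = i by omega] at hxt'
  rw [hxs', hxt', ← div_eq_mul_inv, div_lt_iff₀ hs, ← div_eq_inv_mul, lt_div_iff₀ ht]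
  exact hlt

/-- The linear polynomial representing a linear functional in the coordinates of a basis. -/
noncomputable def linearPolynomial {ι V : Type*} [Fintype ι] [AddCommGroup V] [Module ℝ V]
    (b : Basis ι ℝ V) (f : V →ₗ[ℝ] ℝ) : MvPolynomial ι ℝ :=
  ∑ i, MvPolynomial.C (f (b i)) * MvPolynomial.X i

theorem eval_linearPolynomial {ι V : Type*} [Fintype ι] [AddCommGroup V] [Module ℝ V]
    (b : Basis ι ℝ V) (f : V →ₗ[ℝ] ℝ) (v : V) :
    MvPolynomial.eval (b.repr v) (linearPolynomial b f) = f v := by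
  conv_rhs => rw [← b.sum_repr v, map_sum]
  simp [linearPolynomial, mul_comm]

/-- The point of the affine space over `ℝ` given by the coordinates of a vector. -/
noncomputable def zariskiPoint {ι V : Type*} [AddCommGroup V] [Module ℝ V]
    (b : Basis ι ℝ V) (v : V) : PrimeSpectrum (MvPolynomial ι ℝ) :=
  ⟨RingHom.ker (MvPolynomial.eval (b.repr v)), RingHom.ker_isPrime _⟩

/-- The Zariski topology on a real vector space with a given basis. -/
noncomputable abbrev zariskiTopology {ι V : Type*} [AddCommGroup V] [Module ℝ V] (b : Basis ι ℝ V) :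
    TopologicalSpace V :=
  TopologicalSpace.induced (zariskiPoint b) inferInstance

open Topology in
theorem continuous_zariskiTopology {ι V : Type*} [Fintype ι] [AddCommGroup V] [Module ℝ V]
    (b : Basis ι ℝ V) (f : V →ₗ[ℝ] V) :
    Continuous[zariskiTopology b, zariskiTopology b] f := by
  let φ : MvPolynomial ι ℝ →ₐ[ℝ] MvPolynomial ι ℝ :=
    MvPolynomial.aeval fun i => linearPolynomial b (b.coord i ∘ₗ f)
  have hφ : ∀ v p, MvPolynomial.eval (b.repr v) (φ p) = MvPolynomial.eval (b.repr (f v)) p := by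
    intro v p
    induction p using MvPolynomial.induction_on with
    | C a => simp [φ]
    | add p q hp hq => simp [hp, hq]
    | mul_X p i hp =>
      rw [map_mul, map_mul, hp, map_mul]
      simp [φ, eval_linearPolynomial]
  have hcomp : zariskiPoint b ∘ f = PrimeSpectrum.comap φ.toRingHom ∘ zariskiPoint b := by
    funext v
    ext p
    simp [zariskiPoint, RingHom.mem_ker, hφ]
  let := zariskiTopology b
  rw [continuous_induced_rng, hcomp]
  exact (PrimeSpectrum.continuous_comap _).comp continuous_induced_dom

open Topology in
theorem isClosed_zariskiTopology {ι V : Type*} [AddCommGroup V] [Module ℝ V]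
    (b : Basis ι ℝ V) (p : MvPolynomial ι ℝ) :
    IsClosed[zariskiTopology b] {v | MvPolynomial.eval (b.repr v) p = 0} := by
  let := zariskiTopology b
  convert (PrimeSpectrum.isClosed_zeroLocus {p}).preimage
    (continuous_induced_dom (f := zariskiPoint b)) using 1
  ext v
  simp [zariskiPoint, RingHom.mem_ker]

open Matrix in
/-- Failure of transversality to `F` of the image of `E`, for complementary dimensions, is a
polynomial condition. -/
theorem exists_polynomial_map_inf_ne_bot {ι H : Type*} [Fintype ι] [AddCommGroup H] [Module ℝ H]
    [FiniteDimensional ℝ H] (b : Basis ι ℝ (H →ₗ[ℝ] H)) (E F : Submodule ℝ H)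
    (hEF : finrank ℝ E + finrank ℝ F = finrank ℝ H) :
    ∃ p : MvPolynomial ι ℝ, ∀ x : H ≃ₗ[ℝ] H,
      E.map x.toLinearMap ⊓ F ≠ ⊥ ↔ MvPolynomial.eval (b.repr x.toLinearMap) p = 0 := by
  have hq : finrank ℝ (H ⧸ F) = finrank ℝ E := by
    have := F.finrank_quotient_add_finrank
    omega
  let bE := finBasis ℝ E
  let bQ := finBasisOfFinrankEq ℝ (H ⧸ F) hq
  let A : (H →ₗ[ℝ] H) →ₗ[ℝ] Matrix (Fin (finrank ℝ E)) (Fin (finrank ℝ E)) ℝ :=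
    (LinearMap.toMatrix bE bQ).toLinearMap ∘ₗ LinearMap.lcomp ℝ _ E.subtype ∘ₗ
      LinearMap.llcomp ℝ H H _ F.mkQ
  have hA : ∀ x, A x = LinearMap.toMatrix bE bQ (F.mkQ ∘ₗ x ∘ₗ E.subtype) := fun _ => rfl
  refine ⟨(Matrix.of fun i j =>
    linearPolynomial b (LinearMap.proj j ∘ₗ LinearMap.proj i ∘ₗ A)).det, fun x => ?_⟩
  have hdet : MvPolynomial.eval (b.repr x.toLinearMap) (Matrix.of fun i j =>
      linearPolynomial b (LinearMap.proj j ∘ₗ LinearMap.proj i ∘ₗ A)).det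
      = (A x.toLinearMap).det := by
    rw [RingHom.map_det]
    congr 1
    ext i j
    simp only [RingHom.mapMatrix_apply, Matrix.map_apply, Matrix.of_apply, eval_linearPolynomial]
    rfl
  rw [hdet, ← Matrix.exists_mulVec_eq_zero_iff, Submodule.ne_bot_iff]
  have hmul : ∀ u : E, A x.toLinearMap *ᵥ (bE.repr u) = 0 ↔ x u ∈ F := fun u => by
    rw [hA, LinearMap.toMatrix_mulVec_repr]
    simp
  constructor
  · rintro ⟨_, ⟨⟨u, hu, rfl⟩, huF⟩, hne⟩
    refine ⟨bE.repr ⟨u, hu⟩, fun h => hne ?_, (hmul ⟨u, hu⟩).2 huF⟩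
    have : bE.repr ⟨u, hu⟩ = 0 := Finsupp.coe_eq_zero.1 h
    have : u = 0 := by simpa using this
    simp [this]
  · rintro ⟨v, hv, hAv⟩
    obtain ⟨u, rfl⟩ := bE.equivFun.surjective v
    refine ⟨x u, ⟨⟨u, u.2, rfl⟩, (hmul u).1 hAv⟩, fun h => hv ?_⟩
    have : u = 0 := by simpa using h
    simp [this]

theorem IsTwisting.image_symm {H : Type*} [NormedAddCommGroup H] [InnerProductSpace ℝ H]
    [FiniteDimensional ℝ H] {M : Submonoid (H ≃ₗ[ℝ] H)}
    (h : IsTwisting (M : Set (H ≃ₗ[ℝ] H))) :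
    IsTwisting ((fun x : H ≃ₗ[ℝ] H => x.symm) '' (M : Set (H ≃ₗ[ℝ] H))) := by
  classical
  intro k hk hkd F hF 𝒢 h𝒢
  by_contra! hcon
  let b := finBasis ℝ (H →ₗ[ℝ] H)
  let : TopologicalSpace (H →ₗ[ℝ] H) := zariskiTopology b
  let : TopologicalSpace (H ≃ₗ[ℝ] H) :=
    TopologicalSpace.induced (fun x => x.toLinearMap) inferInstance
  have : TopologicalSpace.NoetherianSpace (H →ₗ[ℝ] H) :=
    (Topology.IsInducing.mk rfl : Topology.IsInducing (zariskiPoint b)).noetherianSpace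
  have hind : Topology.IsInducing (fun x : H ≃ₗ[ℝ] H => x.toLinearMap) := ⟨rfl⟩
  have : TopologicalSpace.NoetherianSpace (H ≃ₗ[ℝ] H) := hind.noetherianSpace
  have hmul : ∀ g : H ≃ₗ[ℝ] H, Continuous fun x => g * x := fun g =>
    hind.continuous_iff.2
      ((continuous_zariskiTopology b (LinearMap.llcomp ℝ H H H g.toLinearMap)).comp hind.continuous)
  let V : Submodule ℝ H → Set (H ≃ₗ[ℝ] H) := fun G => {x | G.map x.toLinearMap ⊓ F ≠ ⊥}
  have hclosed : ∀ W ∈ 𝒢.image V, IsClosed W := by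
    intro W hW
    obtain ⟨G, hG, rfl⟩ := Finset.mem_image.1 hW
    obtain ⟨p, hp⟩ := exists_polynomial_map_inf_ne_bot b G F (by rw [h𝒢 G hG, hF]; omega)
    simp only [V, hp]
    exact (isClosed_zariskiTopology b p).preimage hind.continuous
  have hcover : (M : Set (H ≃ₗ[ℝ] H)) ⊆ ⋃₀ ↑(𝒢.image V) := by
    intro x hx
    obtain ⟨G, hG, hne⟩ := hcon x.symm ⟨x, hx, rfl⟩
    refine ⟨V G, by simpa using ⟨G, hG, rfl⟩, ?_⟩
    obtain ⟨_, ⟨⟨u, hu, rfl⟩, huG⟩, hu0⟩ := (Submodule.ne_bot_iff _).1 hne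
    exact (Submodule.ne_bot_iff _).2
      ⟨u, ⟨⟨x.symm u, huG, by simp⟩, hu⟩, fun h0 => hu0 (by simp [h0])⟩
  obtain ⟨W, hW, T, hT⟩ := exists_finset_translates_cover hmul M _ hclosed hcover
  obtain ⟨G, hG, rfl⟩ := Finset.mem_image.1 hW
  obtain ⟨x, hx, hxT⟩ := h (finrank ℝ H - k) (by omega) (by omega) G (h𝒢 G hG)
    (T.image fun g => F.map g.toLinearMap) (by
      intro G' hG'
      obtain ⟨g, -, rfl⟩ := Finset.mem_image.1 hG'
      rw [LinearEquiv.finrank_map_eq g F, hF]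
      omega)
  obtain ⟨g, hg, hgx⟩ := hT x hx
  obtain ⟨_, ⟨⟨u, hu, rfl⟩, huF⟩, hu0⟩ := (Submodule.ne_bot_iff _).1 hgx
  have hgu : g ((g⁻¹ * x) u) = x u := g.apply_symm_apply (x u)
  have hmem : x u ∈ G.map x.toLinearMap ⊓ F.map g.toLinearMap := ⟨⟨u, hu, rfl⟩, ⟨_, huF, hgu⟩⟩
  rw [hxT _ (Finset.mem_image_of_mem _ hg), Submodule.mem_bot] at hmem
  have : u = 0 := by simpa using hmem
  exact hu0 (by simp [this])

/-- If a monoid of linear isomorphisms is simple (twisting and pinching), then so is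
the inverse monoid `ℬ⁻¹ = {x⁻¹ : x ∈ ℬ}`. -/
theorem stmt14 {H : Type*} [NormedAddCommGroup H] [InnerProductSpace ℝ H]
    [FiniteDimensional ℝ H] (M : Submonoid (H ≃ₗ[ℝ] H))
    (htw : IsTwisting (M : Set (H ≃ₗ[ℝ] H)))
    (hpin : IsPinching (M : Set (H ≃ₗ[ℝ] H))) :
    IsTwisting ((fun x : H ≃ₗ[ℝ] H => x.symm) '' (M : Set (H ≃ₗ[ℝ] H))) ∧
    IsPinching ((fun x : H ≃ₗ[ℝ] H => x.symm) '' (M : Set (H ≃ₗ[ℝ] H))) := by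
  exact ⟨htw.image_symm, hpin.image_symm⟩
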